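/- Let h : (0, ∞) → ℝ be continuously differentiable and define g : ℂ \ {0} → 2×2 complex matrices by g(z) = diag(|z|^{−1/4} e^{−h(|z|)/2}, |z|^{1/4} e^{h(|z|)/2}). Then for every z ≠ 0: (i) g(z)⁻¹ ∂_z̄ g(z) = −(f(|z|)/conj(z)) · diag(1, −1), where f(r) = 1/8 + (1/4) r h'(r); and (ii) g(z)⁻¹ φ(z) g(z) = [[0, |z|^{1/2} e^{h(|z|)}], [z |z|^{−1/2} e^{−h(|z|)}, 0]]. -/

import Mathlib

open Matrix Complex

/-- Wirtinger derivative `∂_z f = (1/2)(∂f/∂x − i ∂f/∂y)` of `f : ℂ → ℂ`. -/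
noncomputable def wd (f : ℂ → ℂ) (z : ℂ) : ℂ :=
  (1 / 2) * (fderiv ℝ f z 1 - Complex.I * fderiv ℝ f z Complex.I)

/-- Wirtinger derivative `∂_z̄ f = (1/2)(∂f/∂x + i ∂f/∂y)` of `f : ℂ → ℂ`. -/
noncomputable def wdbar (f : ℂ → ℂ) (z : ℂ) : ℂ :=
  (1 / 2) * (fderiv ℝ f z 1 + Complex.I * fderiv ℝ f z Complex.I)

/-- Entrywise Wirtinger derivative `∂_z̄` of a matrix-valued function. -/
noncomputable def wdbarM (f : ℂ → Matrix (Fin 2) (Fin 2) ℂ) (z : ℂ) : Matrix (Fin 2) (Fin 2) ℂ :=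
  Matrix.of fun i j => wdbar (fun w => f w i j) z

noncomputable def phi (z : ℂ) : Matrix (Fin 2) (Fin 2) ℂ := !![0, 1; z, 0]

theorem hasFDerivAt_norm_of_ne_zero {E : Type*} [NormedAddCommGroup E] [InnerProductSpace ℝ E]
    {z : E} (hz : z ≠ 0) :
    HasFDerivAt (fun w : E => ‖w‖) (‖z‖⁻¹ • innerSL ℝ z) z := by
  have hr : ‖z‖ ≠ 0 := norm_ne_zero_iff.mpr hz
  have key := (hasStrictFDerivAt_norm_sq z).hasFDerivAt.sqrt (pow_ne_zero 2 hr)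
  simp only [Real.sqrt_sq (norm_nonneg _)] at key
  refine key.congr_fderiv ?_
  ext w
  simp
  field_simp

/-- A radial function `F(|w|)` satisfies `∂_z̄ F(|z|) = F'(|z|) z / (2 |z|)`. -/
theorem wdbar_comp_norm {F : ℝ → ℝ} {F' : ℝ} {z : ℂ} (hz : z ≠ 0)
    (hF : HasDerivAt F F' ‖z‖) :
    wdbar (fun w => ((F ‖w‖ : ℝ) : ℂ)) z = F' * z / (2 * ‖z‖) := by
  have key := Complex.ofRealCLM.hasFDerivAt.comp z
    (hF.comp_hasFDerivAt z (hasFDerivAt_norm_of_ne_zero hz))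
  have key' : HasFDerivAt (fun w : ℂ => ((F ‖w‖ : ℝ) : ℂ)) _ z := key
  have hr : (‖z‖ : ℂ) ≠ 0 := by exact_mod_cast norm_ne_zero_iff.mpr hz
  rw [wdbar, key'.fderiv]
  simp [Complex.inner]
  field_simp
  linear_combination (F' : ℂ) * Complex.re_add_im z

theorem wdbar_zero (z : ℂ) : wdbar (fun _ => 0) z = 0 := by
  simp [wdbar]

theorem hasDerivAt_rpow_mul_exp {k : ℝ → ℝ} {k' r : ℝ} (p : ℝ) (hr : 0 < r)
    (hk : HasDerivAt k k' r) :
    HasDerivAt (fun x => x ^ p * Real.exp (k x)) (r ^ p * Real.exp (k r) * (p / r + k')) r := by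
  refine ((Real.hasDerivAt_rpow_const (p := p) (Or.inl hr.ne')).mul hk.exp).congr_deriv ?_
  rw [Real.rpow_sub_one hr.ne']
  ring

theorem inv_diag_of_mul_eq_one {a d : ℂ} (had : a * d = 1) :
    (!![a, 0; 0, d] : Matrix (Fin 2) (Fin 2) ℂ)⁻¹ = !![d, 0; 0, a] := by
  apply Matrix.inv_eq_right_inv
  simp [Matrix.one_fin_two, had, mul_comm d a]

theorem stmt14 (h : ℝ → ℝ) (hreg : ContDiffOn ℝ 1 h (Set.Ioi 0))
    (g : ℂ → Matrix (Fin 2) (Fin 2) ℂ)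
    (hg : ∀ z : ℂ, g z =
      !![((‖z‖ ^ (-(1 : ℝ) / 4) * Real.exp (-h ‖z‖ / 2) : ℝ) : ℂ), 0;
         0, ((‖z‖ ^ ((1 : ℝ) / 4) * Real.exp (h ‖z‖ / 2) : ℝ) : ℂ)])
    (f : ℝ → ℝ) (hf : ∀ r : ℝ, f r = 1 / 8 + (1 / 4) * r * deriv h r) :
    ∀ z : ℂ, z ≠ 0 →
      (g z)⁻¹ * wdbarM g z =
        (-((f ‖z‖ : ℝ) : ℂ) / (starRingEnd ℂ) z) •
          (!![1, 0; 0, -1] : Matrix (Fin 2) (Fin 2) ℂ) ∧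
      (g z)⁻¹ * phi z * g z =
        !![0, ((‖z‖ ^ ((1 : ℝ) / 2) * Real.exp (h ‖z‖) : ℝ) : ℂ);
           z * ((‖z‖ ^ (-(1 : ℝ) / 2) * Real.exp (-h ‖z‖) : ℝ) : ℂ), 0] := by
  intro z hz
  have hr : 0 < ‖z‖ := norm_pos_iff.mpr hz
  have hh : HasDerivAt h (deriv h ‖z‖) ‖z‖ :=
    ((hreg.differentiableOn one_ne_zero).differentiableAt (Ioi_mem_nhds hr)).hasDerivAt
  have hA := wdbar_comp_norm hz
    (hasDerivAt_rpow_mul_exp (-(1 : ℝ) / 4) hr (hh.neg.div_const 2))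
  have hD := wdbar_comp_norm hz
    (hasDerivAt_rpow_mul_exp ((1 : ℝ) / 4) hr (hh.div_const 2))
  simp only [Pi.neg_apply] at hA
  have hW : wdbarM g z = !![wdbar (fun w : ℂ =>
        ((‖w‖ ^ (-(1 : ℝ) / 4) * Real.exp (-h ‖w‖ / 2) : ℝ) : ℂ)) z, 0;
      0, wdbar (fun w : ℂ =>
        ((‖w‖ ^ ((1 : ℝ) / 4) * Real.exp (h ‖w‖ / 2) : ℝ) : ℂ)) z] := by
    ext i j
    fin_cases i <;> fin_cases j <;> simp [wdbarM, hg, wdbar_zero]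
  rw [hW, hA, hD, hg z]
  have hmul : ‖z‖ ^ (-(1 : ℝ) / 4) * Real.exp (-h ‖z‖ / 2) *
      (‖z‖ ^ ((1 : ℝ) / 4) * Real.exp (h ‖z‖ / 2)) = 1 := by
    rw [mul_mul_mul_comm, ← Real.rpow_add hr, ← Real.exp_add]
    ring_nf
    simp
  have hsqA : ‖z‖ ^ (-(1 : ℝ) / 2) * Real.exp (-h ‖z‖) =
      (‖z‖ ^ (-(1 : ℝ) / 4) * Real.exp (-h ‖z‖ / 2)) *
        (‖z‖ ^ (-(1 : ℝ) / 4) * Real.exp (-h ‖z‖ / 2)) := by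
    rw [mul_mul_mul_comm, ← Real.rpow_add hr, ← Real.exp_add]
    ring_nf
  have hsqD : ‖z‖ ^ ((1 : ℝ) / 2) * Real.exp (h ‖z‖) =
      (‖z‖ ^ ((1 : ℝ) / 4) * Real.exp (h ‖z‖ / 2)) *
        (‖z‖ ^ ((1 : ℝ) / 4) * Real.exp (h ‖z‖ / 2)) := by
    rw [mul_mul_mul_comm, ← Real.rpow_add hr, ← Real.exp_add]
    ring_nf
  rw [hsqA, hsqD, hf]
  generalize ‖z‖ ^ (-(1 : ℝ) / 4) * Real.exp (-h ‖z‖ / 2) = a at hmul ⊢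
  generalize ‖z‖ ^ ((1 : ℝ) / 4) * Real.exp (h ‖z‖ / 2) = d at hmul ⊢
  have had : (a : ℂ) * d = 1 := by exact_mod_cast hmul
  rw [inv_diag_of_mul_eq_one had]
  have hrC : (‖z‖ : ℂ) ≠ 0 := by exact_mod_cast hr.ne'
  have hconj : (starRingEnd ℂ) z ≠ 0 := by simpa using hz
  have hnorm : z * (starRingEnd ℂ) z = (‖z‖ : ℂ) ^ 2 := Complex.mul_conj' z
  have hzr : z / (2 * ‖z‖) = ‖z‖ / (2 * (starRingEnd ℂ) z) := by
    field_simp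
    linear_combination hnorm
  constructor
  · simp only [Matrix.mul_fin_two, mul_div_assoc, hzr]
    ext i j
    fin_cases i <;> fin_cases j <;> simp
    · field_simp
      linear_combination 16 * (-1 - 2 * ‖z‖ * ((deriv h ‖z‖ : ℝ) : ℂ)) * had
    · field_simp
      linear_combination 16 * (1 + 2 * ‖z‖ * ((deriv h ‖z‖ : ℝ) : ℂ)) * had
  · ext i j
    fin_cases i <;> fin_cases j <;> simp [phi]
    ring
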